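/- arXiv:1511.02381 — 3 statements merged into one kernel-verified Lean document; each statement's English description precedes it below -/
import Mathlib

section
/- If g_0(X;Y) = 0, then lim_{ε→0⁺} g_ε(X;Y)/ε ≥ max_{y ∈ 𝒴} (−log P_Y(y)) / D(P_{X|Y}(·|y) ‖ P_X), where the limit exists since ε ↦ g_ε(X;Y)/ε is monotone. -/
open scoped BigOperators

noncomputable section

namespace RatePrivacy

variable {α β γ : Type*}

/-- `p` is a probability mass function on a finite alphabet. -/
def IsPMF [Fintype α] (p : α → ℝ) : Prop := (∀ a, 0 ≤ p a) ∧ ∑ a, p a = 1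

/-- Shannon entropy (in bits) of the distribution `p`. -/
def ent [Fintype α] (p : α → ℝ) : ℝ := ∑ a, -(p a * Real.logb 2 (p a))

/-- First marginal of a joint distribution. -/
def margA [Fintype α] [Fintype β] (p : α × β → ℝ) : α → ℝ := fun a => ∑ b, p (a, b)

/-- Second marginal of a joint distribution. -/
def margB [Fintype α] [Fintype β] (p : α × β → ℝ) : β → ℝ := fun b => ∑ a, p (a, b)

/-- Mutual information (in bits) of a joint distribution `p`:
`I(A;B) = H(A) + H(B) - H(A,B)`. -/
def mi [Fintype α] [Fintype β] (p : α × β → ℝ) : ℝ :=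
  ent (margA p) + ent (margB p) - ent p

/-- `q` is a (row-stochastic) channel. -/
def IsChannel [Fintype γ] (q : β → γ → ℝ) : Prop :=
  (∀ y z, 0 ≤ q y z) ∧ ∀ y, ∑ z, q y z = 1

/-- Joint distribution of `(X, Z)` when `Z` is obtained from `Y` through the channel `q`
(so that `X — Y — Z` is a Markov chain). -/
def jointXZ [Fintype α] [Fintype β] [Fintype γ] (p : α × β → ℝ) (q : β → γ → ℝ) :
    α × γ → ℝ := fun xz => ∑ y, p (xz.1, y) * q y xz.2

/-- Joint distribution of `(Y, Z)` when `Z` is obtained from `Y` through the channel `q`. -/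
def jointYZ [Fintype α] [Fintype β] [Fintype γ] (p : α × β → ℝ) (q : β → γ → ℝ) :
    β × γ → ℝ := fun yz => margB p yz.1 * q yz.1 yz.2

/-- Achievable rates `I(Y;Z)` over all privacy filters `Z` (on finite alphabets, wlog `Fin n`)
with `X — Y — Z` Markov and `I(X;Z) ≤ ε`. -/
def gSet [Fintype α] [Fintype β] (p : α × β → ℝ) (ε : ℝ) : Set ℝ :=
  { r | ∃ (n : ℕ) (q : β → Fin n → ℝ), IsChannel q ∧
        mi (jointXZ p q) ≤ ε ∧ r = mi (jointYZ p q) }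

/-- The rate-privacy function `g_ε(X;Y)` (privacy measured by mutual information). -/
def g [Fintype α] [Fintype β] (p : α × β → ℝ) (ε : ℝ) : ℝ := sSup (gSet p ε)

/-- Values `E[f(A) g(B)]` over all zero-mean unit-variance `f, g`, used to define
the Hirschfeld–Gebelein–Rényi maximal correlation. -/
def corrSet [Fintype α] [Fintype β] (p : α × β → ℝ) : Set ℝ :=
  { r | ∃ (f : α → ℝ) (g : β → ℝ),
      (∑ a, margA p a * f a = 0) ∧ (∑ b, margB p b * g b = 0) ∧
      (∑ a, margA p a * (f a) ^ 2 = 1) ∧ (∑ b, margB p b * (g b) ^ 2 = 1) ∧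
      r = ∑ x : α × β, p x * (f x.1 * g x.2) }

/-- Maximal correlation `ρ_m(A;B)` (equal to `0` when the constraint set is empty,
since `sSup ∅ = 0` in `ℝ`). -/
def rhoM [Fintype α] [Fintype β] (p : α × β → ℝ) : ℝ := sSup (corrSet p)

/-- Achievable rates with maximal-correlation privacy constraint `ρ_m²(X;Z) ≤ ε`. -/
def ghSet [Fintype α] [Fintype β] (p : α × β → ℝ) (ε : ℝ) : Set ℝ :=
  { r | ∃ (n : ℕ) (q : β → Fin n → ℝ), IsChannel q ∧
        (rhoM (jointXZ p q)) ^ 2 ≤ ε ∧ r = mi (jointYZ p q) }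

/-- The rate-privacy function `ĝ_ε(X;Y)` (privacy measured by squared maximal correlation). -/
def gh [Fintype α] [Fintype β] (p : α × β → ℝ) (ε : ℝ) : ℝ := sSup (ghSet p ε)

/-- The Kullback–Leibler divergence (in bits) `D(P_{X|Y}(·|y) ‖ P_X)`. -/
def Dxy [Fintype α] [Fintype β] (p : α × β → ℝ) (y : β) : ℝ :=
  ∑ x, (p (x, y) / margB p y) * Real.logb 2 ((p (x, y) / margB p y) / margA p x)

open Real in
lemma ent_eq_sum_negMulLog [Fintype α] (p : α → ℝ) :
    ent p = (∑ a, negMulLog (p a)) / log 2 := by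
  simp only [ent, negMulLog, Finset.sum_div, logb]
  exact Finset.sum_congr rfl fun a _ => by ring

/-- Grouping does not increase entropy: a marginal has at most the entropy of the joint law. -/
lemma ent_margB_le_ent [Fintype α] [Fintype β] {p : α × β → ℝ} (hp : ∀ x, 0 ≤ p x) :
    ent (margB p) ≤ ent p := by
  unfold ent
  rw [Fintype.sum_prod_type_right]
  refine Finset.sum_le_sum fun b _ => ?_
  conv_lhs => rw [← neg_mul, margB, ← Finset.sum_neg_distrib, Finset.sum_mul]
  refine Finset.sum_le_sum fun a _ => ?_
  rcases (hp (a, b)).eq_or_lt with h | h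
  · simp [← h]
  · rw [neg_mul]
    refine neg_le_neg (mul_le_mul_of_nonneg_left ?_ h.le)
    exact Real.logb_le_logb_of_le one_lt_two h
      (Finset.single_le_sum (f := fun a => p (a, b)) (fun a _ => hp (a, b)) (Finset.mem_univ a))

lemma IsPMF.sum_margA [Fintype α] [Fintype β] {p : α × β → ℝ} (hp : IsPMF p) :
    ∑ a, margA p a = 1 := by
  rw [← hp.2, Fintype.sum_prod_type]
  rfl

lemma margB_nonneg [Fintype α] [Fintype β] {p : α × β → ℝ} (hp : IsPMF p) (b : β) :
    0 ≤ margB p b :=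
  Finset.sum_nonneg fun a _ => hp.1 (a, b)

lemma margA_jointXZ [Fintype α] [Fintype β] [Fintype γ] (p : α × β → ℝ) {q : β → γ → ℝ}
    (hq : IsChannel q) : margA (jointXZ p q) = margA p := by
  funext x
  simp only [margA, jointXZ]
  rw [Finset.sum_comm]
  simp [← Finset.mul_sum, hq.2]

lemma sum_jointXZ [Fintype α] [Fintype β] [Fintype γ] {p : α × β → ℝ} (hp : IsPMF p)
    {q : β → γ → ℝ} (hq : IsChannel q) : ∑ x, ∑ z, jointXZ p q (x, z) = 1 := by
  rw [← hp.sum_margA, ← margA_jointXZ p hq]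
  rfl

open Classical in
/-- The law of `(Y, Y)` when `Y` has distribution `r`. -/
def diagonal (r : β → ℝ) : β × β → ℝ := fun x => if x.1 = x.2 then r x.2 else 0

lemma margA_diagonal [Fintype β] (r : β → ℝ) : margA (diagonal r) = r := by
  classical
  funext b
  simp [margA, diagonal]

lemma margB_diagonal [Fintype β] (r : β → ℝ) : margB (diagonal r) = r := by
  classical
  funext b
  simp [margB, diagonal]

lemma isPMF_diagonal [Fintype β] {r : β → ℝ} (hr : IsPMF r) : IsPMF (diagonal r) := by
  refine ⟨fun x => ?_, ?_⟩
  · unfold diagonal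
    split_ifs
    exacts [hr.1 _, le_rfl]
  · rw [← hr.2, Fintype.sum_prod_type]
    exact Finset.sum_congr rfl fun b _ => congrFun (margA_diagonal r) b

lemma isPMF_margB [Fintype α] [Fintype β] {p : α × β → ℝ} (hp : IsPMF p) : IsPMF (margB p) := by
  refine ⟨margB_nonneg hp, ?_⟩
  rw [← hp.2, Fintype.sum_prod_type_right]
  rfl

lemma jointXZ_diagonal [Fintype α] [Fintype β] [Fintype γ] (p : α × β → ℝ) (q : β → γ → ℝ) :
    jointXZ (diagonal (margB p)) q = jointYZ p q := by
  classical
  funext x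
  simp [jointXZ, jointYZ, diagonal]

lemma Dxy_diagonal [Fintype β] {r : β → ℝ} {y : β} (hy : 0 < r y) :
    Dxy (diagonal r) y = -Real.logb 2 (r y) := by
  simp only [Dxy, margA_diagonal, margB_diagonal]
  rw [Finset.sum_eq_single y]
  · simp [diagonal, hy.ne']
  · intro b _ hb
    simp [diagonal, hb]
  · simp

/-- The channel that outputs an erasure symbol with probability `1 - t` and follows `q`
otherwise. -/
def erase {n : ℕ} (t : ℝ) (q : β → Fin n → ℝ) : β → Fin (n + 1) → ℝ :=
  fun y => Fin.cons (1 - t) fun z => t * q y z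

lemma isChannel_erase {n : ℕ} {t : ℝ} (h0 : 0 ≤ t) (h1 : t ≤ 1) {q : β → Fin n → ℝ}
    (hq : IsChannel q) : IsChannel (erase t q) := by
  refine ⟨fun y z => ?_, fun y => ?_⟩
  · refine Fin.cases ?_ (fun z => ?_) z
    · simpa [erase] using h1
    · simpa [erase] using mul_nonneg h0 (hq.1 y z)
  · simp [erase, Fin.sum_univ_succ, ← Finset.mul_sum, hq.2]

lemma mi_jointXZ_erase [Fintype α] [Fintype β] {p : α × β → ℝ} (hp : IsPMF p) {n : ℕ} {t : ℝ}
    (h0 : 0 ≤ t) (h1 : t ≤ 1) {q : β → Fin n → ℝ} (hq : IsChannel q) :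
    mi (jointXZ p (erase t q)) = t * mi (jointXZ p q) := by
  have hzero : ∀ x, jointXZ p (erase t q) (x, 0) = (1 - t) * margA p x := by
    intro x
    simp [jointXZ, erase, margA, Finset.mul_sum, mul_comm]
  have hsucc : ∀ x z, jointXZ p (erase t q) (x, Fin.succ z) = t * jointXZ p q (x, z) := by
    intro x z
    simp only [jointXZ, erase, Fin.cons_succ, Finset.mul_sum]
    exact Finset.sum_congr rfl fun y _ => by ring
  have hBzero : margB (jointXZ p (erase t q)) 0 = 1 - t := by
    simp only [margB, hzero]
    rw [← Finset.mul_sum, hp.sum_margA, mul_one]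
  have hBsucc : ∀ z, margB (jointXZ p (erase t q)) (Fin.succ z)
      = t * margB (jointXZ p q) z := by
    intro z
    simp only [margB, hsucc, Finset.mul_sum]
  have hB : ∑ z, margB (jointXZ p q) z = 1 := by
    simp only [margB]
    rw [Finset.sum_comm, sum_jointXZ hp hq]
  simp only [mi, margA_jointXZ p hq, margA_jointXZ p (isChannel_erase h0 h1 hq),
    ent_eq_sum_negMulLog, Fintype.sum_prod_type, Fin.sum_univ_succ, hzero, hsucc, hBzero, hBsucc,
    Real.negMulLog_mul, Finset.sum_add_distrib, ← Finset.sum_mul, ← Finset.mul_sum, hB,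
    hp.sum_margA, sum_jointXZ hp hq]
  ring

lemma erase_mem_gSet [Fintype α] [Fintype β] {p : α × β → ℝ} (hp : IsPMF p) {ε r t : ℝ}
    (h0 : 0 ≤ t) (h1 : t ≤ 1) (hr : r ∈ gSet p ε) : t * r ∈ gSet p (t * ε) := by
  obtain ⟨n, q, hq, hε, rfl⟩ := hr
  refine ⟨n + 1, erase t q, isChannel_erase h0 h1 hq, ?_, ?_⟩
  · rw [mi_jointXZ_erase hp h0 h1 hq]
    exact mul_le_mul_of_nonneg_left hε h0
  · rw [← jointXZ_diagonal, ← jointXZ_diagonal,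
      mi_jointXZ_erase (isPMF_diagonal (isPMF_margB hp)) h0 h1 hq]

lemma zero_mem_gSet [Fintype α] [Fintype β] {p : α × β → ℝ} (hp : IsPMF p) {ε : ℝ}
    (hε : 0 ≤ ε) : (0 : ℝ) ∈ gSet p ε := by
  have hq : IsChannel (fun (_ : β) (_ : Fin 1) => (1 : ℝ)) := by simp [IsChannel]
  have h := erase_mem_gSet hp le_rfl zero_le_one ⟨1, _, hq, le_rfl, rfl⟩
  rw [zero_mul, zero_mul] at h
  obtain ⟨n, q, hq, h, hr⟩ := h
  exact ⟨n, q, hq, h.trans hε, hr⟩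

lemma bddAbove_gSet [Fintype α] [Fintype β] {p : α × β → ℝ} (hp : IsPMF p) (ε : ℝ) :
    BddAbove (gSet p ε) := by
  refine ⟨ent (margB p), ?_⟩
  rintro r ⟨n, q, hq, -, rfl⟩
  have h := ent_margB_le_ent (p := jointYZ p q)
    fun x => mul_nonneg (margB_nonneg hp x.1) (hq.1 x.1 x.2)
  have hA : margA (jointYZ p q) = margB p := by
    rw [← jointXZ_diagonal, margA_jointXZ _ hq, margA_diagonal]
  rw [mi, hA]
  linarith

lemma g_nonneg [Fintype α] [Fintype β] {p : α × β → ℝ} (hp : IsPMF p) {ε : ℝ} (hε : 0 ≤ ε) :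
    0 ≤ g p ε :=
  le_csSup (bddAbove_gSet hp ε) (zero_mem_gSet hp hε)

lemma antitoneOn_g_div [Fintype α] [Fintype β] {p : α × β → ℝ} (hp : IsPMF p) :
    AntitoneOn (fun ε => g p ε / ε) (Set.Ioi 0) := by
  intro ε hε δ hδ h
  rw [Set.mem_Ioi] at hε hδ
  have ht : 0 < ε / δ := div_pos hε hδ
  have key : g p δ ≤ g p ε / (ε / δ) := by
    refine csSup_le ⟨0, zero_mem_gSet hp hδ.le⟩ fun r hr => ?_
    rw [le_div_iff₀ ht, mul_comm]
    have hmem := erase_mem_gSet hp ht.le ((div_le_one hδ).2 h) hr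
    rw [div_mul_cancel₀ _ hδ.ne'] at hmem
    exact le_csSup (bddAbove_gSet hp ε) hmem
  show g p δ / δ ≤ g p ε / ε
  rw [div_le_iff₀ hδ]
  calc g p δ ≤ g p ε / (ε / δ) := key
    _ = g p ε / ε * δ := by field_simp

open Classical in
/-- The binary channel that reveals the letter `y` with probability `δ`. -/
def reveal (y : β) (δ : ℝ) : β → Fin 2 → ℝ :=
  fun b => ![1 - δ * if b = y then 1 else 0, δ * if b = y then 1 else 0]

lemma isChannel_reveal (y : β) {δ : ℝ} (h0 : 0 ≤ δ) (h1 : δ ≤ 1) :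
    IsChannel (reveal y δ) := by
  refine ⟨fun b z => ?_, fun b => ?_⟩
  · fin_cases z <;> simp only [reveal] <;> split_ifs <;> simp [h0, h1]
  · simp [reveal]

open Real in
lemma mi_jointXZ_reveal [Fintype α] [Fintype β] {p : α × β → ℝ} (hp : IsPMF p) (y : β) {δ : ℝ}
    (h0 : 0 ≤ δ) (h1 : δ ≤ 1) :
    mi (jointXZ p (reveal y δ)) =
      (δ * (negMulLog (margB p y) - ∑ x, negMulLog (p (x, y))) + negMulLog (1 - δ * margB p y)
        + ∑ x, (negMulLog (margA p x) - negMulLog (margA p x - δ * p (x, y)))) / log 2 := by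
  classical
  have hone : ∀ x, jointXZ p (reveal y δ) (x, 1) = δ * p (x, y) := by
    intro x
    simp [jointXZ, reveal, mul_comm δ]
  have hzero : ∀ x, jointXZ p (reveal y δ) (x, 0) = margA p x - δ * p (x, y) := by
    intro x
    simp [jointXZ, reveal, margA, mul_sub, mul_comm δ]
  have hBone : margB (jointXZ p (reveal y δ)) 1 = δ * margB p y := by
    simp only [margB, hone, Finset.mul_sum]
  have hBzero : margB (jointXZ p (reveal y δ)) 0 = 1 - δ * margB p y := by
    simp only [margB, hzero, Finset.sum_sub_distrib, hp.sum_margA, Finset.mul_sum]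
  have hsum : ∑ x, p (x, y) = margB p y := rfl
  simp only [mi, margA_jointXZ p (isChannel_reveal y h0 h1), ent_eq_sum_negMulLog,
    Fintype.sum_prod_type, Fin.sum_univ_two, hzero, hone, hBzero, hBone, negMulLog_mul,
    Finset.sum_add_distrib, Finset.sum_sub_distrib, ← Finset.sum_mul, ← Finset.mul_sum, hsum]
  ring

open Real in
lemma hasDerivAt_reveal [Fintype α] [Fintype β] {p : α × β → ℝ} (hp : IsPMF p) {y : β}
    (hy : 0 < margB p y) :
    HasDerivAt (fun δ =>
      (δ * (negMulLog (margB p y) - ∑ x, negMulLog (p (x, y))) + negMulLog (1 - δ * margB p y)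
        + ∑ x, (negMulLog (margA p x) - negMulLog (margA p x - δ * p (x, y)))) / log 2)
      (margB p y * Dxy p y) 0 := by
  have hterm : ∀ x, HasDerivAt
      (fun δ => negMulLog (margA p x) - negMulLog (margA p x - δ * p (x, y)))
      (p (x, y) * (-log (margA p x) - 1)) 0 := by
    intro x
    rcases (hp.1 (x, y)).eq_or_lt with h | h
    · simpa [← h] using hasDerivAt_const (0 : ℝ) (0 : ℝ)
    · have hA : 0 < margA p x := h.trans_le
        (Finset.single_le_sum (f := fun b => p (x, b)) (fun b _ => hp.1 (x, b))
          (Finset.mem_univ y))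
      have hin : HasDerivAt (fun δ : ℝ => margA p x - δ * p (x, y)) (-p (x, y)) 0 := by
        simpa using ((hasDerivAt_id (0 : ℝ)).mul_const (p (x, y))).const_sub (margA p x)
      have hout : HasDerivAt negMulLog (-log (margA p x) - 1)
          (margA p x - 0 * p (x, y)) := by
        simpa using hasDerivAt_negMulLog hA.ne'
      have hcomp := (hout.comp (0 : ℝ) hin).const_sub (negMulLog (margA p x))
      exact hcomp.congr_deriv (by ring)
  have hB : HasDerivAt (fun δ : ℝ => negMulLog (1 - δ * margB p y)) (margB p y) 0 := by
    have hin : HasDerivAt (fun δ : ℝ => 1 - δ * margB p y) (-margB p y) 0 := by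
      simpa using ((hasDerivAt_id (0 : ℝ)).mul_const (margB p y)).const_sub 1
    have hout : HasDerivAt negMulLog (-1) (1 - 0 * margB p y) := by
      simpa using hasDerivAt_negMulLog one_ne_zero
    exact (hout.comp (0 : ℝ) hin).congr_deriv (by ring)
  have hlin := (hasDerivAt_id (0 : ℝ)).mul_const
    (negMulLog (margB p y) - ∑ x, negMulLog (p (x, y)))
  refine (((hlin.add hB).add (HasDerivAt.fun_sum fun x _ => hterm x)).div_const
    (log 2)).congr_deriv ?_
  have hD : margB p y * Dxy p y
      = (∑ x, p (x, y) * (log (p (x, y)) - log (margB p y) - log (margA p x))) / log 2 := by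
    rw [Dxy, Finset.mul_sum, Finset.sum_div]
    refine Finset.sum_congr rfl fun x _ => ?_
    rcases (hp.1 (x, y)).eq_or_lt with h | h
    · simp [← h]
    · have hA : 0 < margA p x := h.trans_le
        (Finset.single_le_sum (f := fun b => p (x, b)) (fun b _ => hp.1 (x, b))
          (Finset.mem_univ y))
      rw [logb, log_div (div_pos h hy).ne' hA.ne', log_div h.ne' hy.ne']
      field_simp
  have hsum : ∑ x, p (x, y) = margB p y := rfl
  rw [hD]
  simp only [negMulLog, mul_sub, Finset.sum_sub_distrib, ← Finset.sum_mul, hsum, mul_neg, neg_mul,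
    Finset.sum_neg_distrib, mul_one, one_mul]
  ring

/-- Revealing `y` with small probability `δ` leaks information at the rate `P(y) D(y)`. -/
lemma tendsto_mi_reveal_div [Fintype α] [Fintype β] {p : α × β → ℝ} (hp : IsPMF p) {y : β}
    (hy : 0 < margB p y) :
    Filter.Tendsto (fun δ => mi (jointXZ p (reveal y δ)) / δ)
      (nhdsWithin 0 (Set.Ioi 0)) (nhds (margB p y * Dxy p y)) := by
  refine (hasDerivAt_reveal hp hy).tendsto_slope_zero_right.congr' ?_
  filter_upwards [Ioo_mem_nhdsGT one_pos] with δ hδ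
  rw [mi_jointXZ_reveal hp y hδ.1.le hδ.2.le]
  simp
  ring

lemma reveal_ratio_le [Fintype α] [Fintype β] {p : α × β → ℝ} (hp : IsPMF p) {y : β}
    (hy : 0 < margB p y) (hD : 0 < Dxy p y) {L : EReal}
    (hL : Filter.Tendsto (fun ε : ℝ => ((g p ε / ε : ℝ) : EReal))
      (nhdsWithin 0 (Set.Ioi 0)) (nhds L)) :
    ((-Real.logb 2 (margB p y) / Dxy p y : ℝ) : EReal) ≤ L := by
  have hX := tendsto_mi_reveal_div hp hy
  have hY := tendsto_mi_reveal_div (isPMF_diagonal (isPMF_margB hp)) (y := y)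
    (by rwa [margB_diagonal])
  rw [margB_diagonal, Dxy_diagonal hy] at hY
  simp only [jointXZ_diagonal] at hY
  have hpos : ∀ᶠ δ in nhdsWithin (0 : ℝ) (Set.Ioi 0), 0 < mi (jointXZ p (reveal y δ)) := by
    filter_upwards [hX.eventually_const_lt (mul_pos hy hD), self_mem_nhdsWithin] with δ h hδ
    exact (div_pos_iff_of_pos_right hδ).1 h
  have hzero : Filter.Tendsto (fun δ => mi (jointXZ p (reveal y δ)))
      (nhdsWithin 0 (Set.Ioi 0)) (nhdsWithin 0 (Set.Ioi 0)) := by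
    refine tendsto_nhdsWithin_iff.2 ⟨?_, hpos⟩
    have h := hX.mul (tendsto_nhdsWithin_of_tendsto_nhds (s := Set.Ioi (0 : ℝ))
      (Filter.tendsto_id (x := nhds (0 : ℝ))))
    rw [mul_zero] at h
    refine h.congr' ?_
    filter_upwards [self_mem_nhdsWithin] with δ hδ
    exact div_mul_cancel₀ _ (ne_of_gt hδ)
  have hratio : Filter.Tendsto
      (fun δ => mi (jointYZ p (reveal y δ)) / mi (jointXZ p (reveal y δ)))
      (nhdsWithin 0 (Set.Ioi 0)) (nhds (-Real.logb 2 (margB p y) / Dxy p y)) := by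
    have h := hY.div hX (mul_pos hy hD).ne'
    rw [mul_div_mul_left _ _ hy.ne'] at h
    refine h.congr' ?_
    filter_upwards [self_mem_nhdsWithin] with δ hδ
    exact div_div_div_cancel_right₀ (ne_of_gt hδ) _ _
  refine le_of_tendsto_of_tendsto (EReal.tendsto_coe.2 hratio) (hL.comp hzero) ?_
  filter_upwards [hpos, Ioo_mem_nhdsGT one_pos] with δ hδ h01
  refine EReal.coe_le_coe_iff.2 (div_le_div_of_nonneg_right ?_ hδ.le)
  exact le_csSup (bddAbove_gSet hp _)
    ⟨2, reveal y δ, isChannel_reveal y h01.1.le h01.2.le, le_rfl, rfl⟩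

/-- If `g_0(X;Y) = 0`, then `lim_{ε→0⁺} g_ε(X;Y)/ε` exists (as an extended
real number, since `ε ↦ g_ε/ε` is monotone) and is at least
`max_{y} (−log P_Y(y)) / D(P_{X|Y}(·|y) ‖ P_X)`. -/
theorem stmt10 {𝓧 𝓨 : Type*} [Fintype 𝓧] [Fintype 𝓨] [Nonempty 𝓨]
    (p : 𝓧 × 𝓨 → ℝ) (hp : IsPMF p)
    (hYpos : ∀ y, 0 < margB p y)
    (hdep : ¬ ∀ x y, p (x, y) = margA p x * margB p y)
    (hg0 : g p 0 = 0) :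
    ∃ L : EReal,
      Filter.Tendsto (fun ε : ℝ => ((g p ε / ε : ℝ) : EReal))
        (nhdsWithin 0 (Set.Ioi 0)) (nhds L) ∧
      ∀ y : 𝓨, (((-(Real.logb 2 (margB p y))) / Dxy p y : ℝ) : EReal) ≤ L := by
  have hL := AntitoneOn.tendsto_nhdsGT (f := fun ε : ℝ => ((g p ε / ε : ℝ) : EReal))
    (fun a ha b hb hab => EReal.coe_le_coe_iff.2 (antitoneOn_g_div hp ha hb hab))
    (OrderTop.bddAbove _)
  refine ⟨_, hL, fun y => ?_⟩
  rcases lt_or_ge 0 (Dxy p y) with hD | hD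
  · exact reveal_ratio_le hp (hYpos y) hD hL
  · refine le_trans ?_ (ge_of_tendsto (b := 0) hL ?_)
    · have hle : margB p y ≤ 1 := (isPMF_margB hp).2 ▸
        Finset.single_le_sum (fun b _ => margB_nonneg hp b) (Finset.mem_univ y)
      exact EReal.coe_nonpos.2 (div_nonpos_of_nonneg_of_nonpos
        (neg_nonneg.2 (Real.logb_nonpos one_lt_two (hYpos y).le hle)) hD)
    · filter_upwards [self_mem_nhdsWithin] with ε hε
      exact EReal.coe_nonneg.2 (div_nonneg (g_nonneg hp (le_of_lt hε)) (le_of_lt hε))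

end RatePrivacy
end
end

section
/- Suppose Y is an erased version of X: 𝒴 = 𝒳 ∪ {e}, P_{Y|X}(x|x) = 1−δ and P_{Y|X}(e|x) = δ for every x ∈ 𝒳, with 0 < δ < 1 and P_X(x) > 0 for all x ∈ 𝒳. Then for every ε ≥ 0, g_ε(X;Y) = H(Y|X) + min{ε, I(X;Y)}. In particular g_0(X;Y) = H(Y|X) = h_b(δ), where h_b is the binary entropy function. -/
open scoped BigOperators

noncomputable section

namespace RatePrivacy

variable {α β γ : Type*}

/-- The joint distribution of `(X, Y)` when `Y` is an erased version of `X`: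
`𝒴 = 𝒳 ⊕ {e}`, `P_{Y|X}(x|x) = 1 − δ` and `P_{Y|X}(e|x) = δ`. -/
def erasureJoint {𝓧 : Type*} [DecidableEq 𝓧] (pX : 𝓧 → ℝ) (δ : ℝ) :
    𝓧 × (𝓧 ⊕ Unit) → ℝ := fun z =>
  Sum.elim (fun x' => if z.1 = x' then (1 - δ) * pX z.1 else 0)
    (fun _ => δ * pX z.1) z.2

/-- A summand of the entropy, in bits. -/
def phi (t : ℝ) : ℝ := -(t * Real.logb 2 t)

lemma phi_mul (s t : ℝ) : phi (s * t) = t * phi s + s * phi t := by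
  have h := Real.negMulLog_mul s t
  simp only [Real.negMulLog, phi, Real.logb] at *
  linear_combination h / Real.log 2

lemma phi_zero : phi 0 = 0 := by simp [phi]

lemma phi_nonneg {t : ℝ} (h0 : 0 ≤ t) (h1 : t ≤ 1) : 0 ≤ phi t := by
  have := mul_nonpos_of_nonneg_of_nonpos h0
    (Real.logb_nonpos (b := 2) (by norm_num) h0 h1)
  simp only [phi]
  linarith

lemma ent_eq_sum_phi [Fintype α] (p : α → ℝ) : ent p = ∑ a, phi (p a) := rfl

lemma sum_phi_const_mul [Fintype α] {p : α → ℝ} (hsum : ∑ x, p x = 1) (c : ℝ) :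
    ∑ x, phi (c * p x) = phi c + c * ent p := by
  simp only [phi_mul, Finset.sum_add_distrib, ← Finset.sum_mul, ← Finset.mul_sum, hsum, one_mul,
    ent_eq_sum_phi]

/-- The entropy summand is subadditive on nonnegative reals. -/
lemma phi_sum_le {ι : Type*} (s : Finset ι) (f : ι → ℝ) (hf : ∀ i ∈ s, 0 ≤ f i) :
    phi (∑ i ∈ s, f i) ≤ ∑ i ∈ s, phi (f i) := by
  simp only [phi, Finset.sum_neg_distrib, neg_le_neg_iff]
  rw [Finset.sum_mul]
  refine Finset.sum_le_sum fun i hi => ?_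
  rcases (hf i hi).eq_or_lt with h | h
  · simp [← h]
  · exact mul_le_mul_of_nonneg_left
      (Real.logb_le_logb_of_le (by norm_num) h (Finset.single_le_sum hf hi)) h.le

lemma ent_margB_le [Fintype α] [Fintype β] (p : α × β → ℝ) (hp : ∀ x, 0 ≤ p x) :
    ent (margB p) ≤ ent p := by
  rw [ent_eq_sum_phi, ent_eq_sum_phi, Fintype.sum_prod_type_right]
  exact Finset.sum_le_sum fun b _ => phi_sum_le _ _ fun a _ => hp _

lemma mi_jointYZ_le_ent [Fintype α] [Fintype β] [Fintype γ] (p : α × β → ℝ)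
    (hp : ∀ x, 0 ≤ p x) {q : β → γ → ℝ} (hq : IsChannel q) :
    mi (jointYZ p q) ≤ ent (margB p) := by
  have hA : margA (jointYZ p q) = margB p := by
    ext y
    simp [margA, jointYZ, ← Finset.mul_sum, hq.2]
  have := ent_margB_le (jointYZ p q) fun yz =>
    mul_nonneg (Finset.sum_nonneg fun _ _ => hp _) (hq.1 _ _)
  simp only [mi, hA]
  linarith

/-- For a Markov chain `X — Y — Z`, `I(Y;Z) ≤ I(X;Z) + H(Y|X)`. -/
lemma mi_jointYZ_le [Fintype α] [Fintype β] [Fintype γ] (p : α × β → ℝ)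
    (hp : ∀ x, 0 ≤ p x) {q : β → γ → ℝ} (hq : IsChannel q) :
    mi (jointYZ p q) ≤ mi (jointXZ p q) + (ent p - ent (margA p)) := by
  have hYA : margA (jointYZ p q) = margB p := by
    ext y
    simp [margA, jointYZ, ← Finset.mul_sum, hq.2]
  have hXA : margA (jointXZ p q) = margA p := by
    ext x
    simp only [margA, jointXZ]
    rw [Finset.sum_comm]
    simp [← Finset.mul_sum, hq.2]
  have hB : margB (jointXZ p q) = margB (jointYZ p q) := by
    ext z
    simp only [margB, jointXZ, jointYZ]
    rw [Finset.sum_comm]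
    simp [Finset.sum_mul]
  have hYZ : ent (jointYZ p q) = ent (margB p) + ∑ y, margB p y * ∑ z, phi (q y z) := by
    simp only [ent_eq_sum_phi, Fintype.sum_prod_type, jointYZ, phi_mul, Finset.sum_add_distrib,
      ← Finset.sum_mul, ← Finset.mul_sum, hq.2, one_mul]
  have hXYZ : ∑ x, ∑ y, ∑ z, phi (p (x, y) * q y z)
      = ent p + ∑ y, margB p y * ∑ z, phi (q y z) := by
    simp only [ent_eq_sum_phi, Fintype.sum_prod_type, phi_mul, Finset.sum_add_distrib,
      ← Finset.sum_mul, ← Finset.mul_sum, hq.2, one_mul, margB]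
    congr 1
    rw [Finset.sum_comm]
    simp [Finset.sum_mul]
  have hle : ent (jointXZ p q) ≤ ∑ x, ∑ y, ∑ z, phi (p (x, y) * q y z) := by
    rw [ent_eq_sum_phi, Fintype.sum_prod_type]
    refine Finset.sum_le_sum fun x _ => ?_
    rw [Finset.sum_comm]
    exact Finset.sum_le_sum fun z _ => phi_sum_le _ _ fun y _ => mul_nonneg (hp _) (hq.1 _ _)
  simp only [mi, hYA, hXA, hB]
  linarith

lemma mi_reindex [Fintype α] [Fintype β] [Fintype γ] (p : α × β → ℝ) (e : γ ≃ β) :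
    mi (fun x : α × γ => p (x.1, e x.2)) = mi p := by
  have hA : margA (fun x : α × γ => p (x.1, e x.2)) = margA p := by
    ext a
    exact e.sum_comp fun b => p (a, b)
  have hB : ent (margB fun x : α × γ => p (x.1, e x.2)) = ent (margB p) :=
    e.sum_comp fun b => phi (margB p b)
  have hE : ent (fun x : α × γ => p (x.1, e x.2)) = ent p :=
    ((Equiv.refl α).prodCongr e).sum_comp fun x => phi (p x)
  rw [mi, mi, hA, hB, hE]

lemma mem_gSet [Fintype α] [Fintype β] [Fintype γ] (p : α × β → ℝ) {ε : ℝ} {q : β → γ → ℝ}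
    (hq : IsChannel q) (hε : mi (jointXZ p q) ≤ ε) : mi (jointYZ p q) ∈ gSet p ε := by
  let e := (Fintype.equivFin γ).symm
  refine ⟨Fintype.card γ, fun y i => q y (e i),
    ⟨fun y i => hq.1 y _, fun y => (e.sum_comp (q y)).trans (hq.2 y)⟩, ?_, ?_⟩
  · exact (mi_reindex (jointXZ p q) e).trans_le hε
  · exact (mi_reindex (jointYZ p q) e).symm

section Erasure

variable {𝓧 : Type*} [Fintype 𝓧] [DecidableEq 𝓧]

/-- The filter that forwards an erasure (as `inr true`), forwards an unerased symbol with
probability `l`, and otherwise replaces it by `inr false`. -/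
def erasureFilter (l : ℝ) : 𝓧 ⊕ Unit → 𝓧 ⊕ Bool → ℝ
  | .inl x, .inl x' => if x = x' then l else 0
  | .inl _, .inr b => if b then 0 else 1 - l
  | .inr _, .inl _ => 0
  | .inr _, .inr b => if b then 1 else 0

lemma isChannel_erasureFilter {l : ℝ} (h0 : 0 ≤ l) (h1 : l ≤ 1) :
    IsChannel (erasureFilter (𝓧 := 𝓧) l) := by
  constructor
  · rintro (x | x) (z | z) <;> simp only [erasureFilter] <;> (try split_ifs) <;> linarith
  · rintro (x | x) <;> simp [erasureFilter]

variable {pX : 𝓧 → ℝ} {δ : ℝ}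

lemma margA_erasureJoint : margA (erasureJoint pX δ) = pX := by
  ext x
  simp [margA, erasureJoint]
  ring

lemma margB_erasureJoint_inl (x : 𝓧) :
    margB (erasureJoint pX δ) (.inl x) = (1 - δ) * pX x := by
  simp [margB, erasureJoint]

lemma margB_erasureJoint_inr (hsum : ∑ x, pX x = 1) (u : Unit) :
    margB (erasureJoint pX δ) (.inr u) = δ := by
  simp [margB, erasureJoint, ← Finset.mul_sum, hsum]

lemma ent_erasureJoint (hsum : ∑ x, pX x = 1) :
    ent (erasureJoint pX δ) = phi δ + phi (1 - δ) + ent pX := by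
  simp only [ent_eq_sum_phi (erasureJoint pX δ), Fintype.sum_prod_type, Fintype.sum_sum_type,
    erasureJoint, Sum.elim_inl, Sum.elim_inr, apply_ite phi, phi_zero, Finset.sum_ite_eq,
    Finset.mem_univ, if_true, Finset.sum_add_distrib, Finset.univ_unique, Finset.sum_singleton,
    sum_phi_const_mul hsum]
  ring

lemma ent_margB_erasureJoint (hsum : ∑ x, pX x = 1) :
    ent (margB (erasureJoint pX δ)) = phi δ + phi (1 - δ) + (1 - δ) * ent pX := by
  simp only [ent_eq_sum_phi (margB _), Fintype.sum_sum_type, margB_erasureJoint_inl,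
    margB_erasureJoint_inr hsum, Finset.univ_unique, Finset.sum_singleton,
    sum_phi_const_mul hsum]
  ring

lemma mi_erasureJoint (hsum : ∑ x, pX x = 1) :
    mi (erasureJoint pX δ) = (1 - δ) * ent pX := by
  rw [mi, margA_erasureJoint, ent_margB_erasureJoint hsum, ent_erasureJoint hsum]
  ring

lemma mi_jointXZ_erasureFilter (hsum : ∑ x, pX x = 1) (l : ℝ) :
    mi (jointXZ (erasureJoint pX δ) (erasureFilter l)) = l * ((1 - δ) * ent pX) := by
  have hl (x x' : 𝓧) : jointXZ (erasureJoint pX δ) (erasureFilter l) (x, .inl x')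
      = if x = x' then (1 - δ) * l * pX x else 0 := by
    simp [jointXZ, erasureJoint, erasureFilter]
    split_ifs <;> ring
  have hr (x : 𝓧) (b : Bool) : jointXZ (erasureJoint pX δ) (erasureFilter l) (x, .inr b)
      = (if b then δ else (1 - δ) * (1 - l)) * pX x := by
    cases b <;> simp [jointXZ, erasureJoint, erasureFilter]
    ring
  simp only [mi, ent_eq_sum_phi (jointXZ _ _), ent_eq_sum_phi (margB _), Fintype.sum_prod_type,
    Fintype.sum_sum_type, margB, hl, hr, apply_ite phi, phi_zero, Finset.sum_ite_eq,
    Finset.sum_ite_eq', Finset.mem_univ, if_true, Finset.sum_add_distrib, Fintype.sum_bool,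
    Bool.false_eq_true, if_false, ← Finset.mul_sum, hsum, mul_one, sum_phi_const_mul hsum]
  have hA : margA (jointXZ (erasureJoint pX δ) (erasureFilter l)) = pX := by
    ext x
    simp [margA, hl, hr]
    ring
  rw [hA]
  ring

lemma mi_jointYZ_erasureFilter (hsum : ∑ x, pX x = 1) {l : ℝ} (h0 : 0 ≤ l) (h1 : l ≤ 1) :
    mi (jointYZ (erasureJoint pX δ) (erasureFilter l))
      = phi δ + phi (1 - δ) + l * ((1 - δ) * ent pX) := by
  have hA : margA (jointYZ (erasureJoint pX δ) (erasureFilter l))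
      = margB (erasureJoint pX δ) := by
    ext y
    simp [margA, jointYZ, ← Finset.mul_sum, (isChannel_erasureFilter h0 h1).2]
  have hll (x x' : 𝓧) : jointYZ (erasureJoint pX δ) (erasureFilter l) (.inl x, .inl x')
      = if x = x' then (1 - δ) * l * pX x else 0 := by
    simp [jointYZ, margB_erasureJoint_inl, erasureFilter]
    split_ifs <;> ring
  have hlr (x : 𝓧) (b : Bool) : jointYZ (erasureJoint pX δ) (erasureFilter l) (.inl x, .inr b)
      = (if b then 0 else (1 - δ) * (1 - l)) * pX x := by
    cases b <;> simp [jointYZ, margB_erasureJoint_inl, erasureFilter]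
    ring
  have hrl (u : Unit) (x' : 𝓧) :
      jointYZ (erasureJoint pX δ) (erasureFilter l) (.inr u, .inl x') = 0 := by
    simp [jointYZ, erasureFilter]
  have hrr (u : Unit) (b : Bool) :
      jointYZ (erasureJoint pX δ) (erasureFilter l) (.inr u, .inr b) = if b then δ else 0 := by
    simp [jointYZ, margB_erasureJoint_inr hsum, erasureFilter]
  simp only [mi, hA, ent_margB_erasureJoint hsum]
  simp only [ent_eq_sum_phi (jointYZ _ _), ent_eq_sum_phi (margB _), Fintype.sum_prod_type,
    Fintype.sum_sum_type, margB, hll, hlr, hrl, hrr, apply_ite phi, phi_zero, Finset.sum_ite_eq,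
    Finset.sum_ite_eq', Finset.mem_univ, if_true, Finset.sum_add_distrib, Fintype.sum_bool,
    Bool.false_eq_true, if_false, ← Finset.mul_sum, hsum, mul_one, sum_phi_const_mul hsum,
    Finset.univ_unique, Finset.sum_singleton, Finset.sum_const_zero, zero_mul, add_zero, zero_add]
  ring

end Erasure

/-- If `Y` is an erased version of `X` with erasure probability
`δ ∈ (0,1)` (and `P_X(x) > 0` for all `x`), then for every `ε ≥ 0`,
`g_ε(X;Y) = H(Y|X) + min{ε, I(X;Y)}`; in particular `g_0(X;Y) = H(Y|X) = h_b(δ)`.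
(Here `H(Y|X) = H(X,Y) − H(X)`.) -/
theorem stmt17 {𝓧 : Type*} [Fintype 𝓧] [DecidableEq 𝓧]
    (pX : 𝓧 → ℝ) (hpX : (∀ x, 0 < pX x) ∧ ∑ x, pX x = 1)
    (δ : ℝ) (hδ0 : 0 < δ) (hδ1 : δ < 1) :
    (∀ ε : ℝ, 0 ≤ ε →
      g (erasureJoint pX δ) ε =
        (ent (erasureJoint pX δ) - ent (margA (erasureJoint pX δ)))
          + min ε (mi (erasureJoint pX δ))) ∧
    g (erasureJoint pX δ) 0
      = ent (erasureJoint pX δ) - ent (margA (erasureJoint pX δ)) ∧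
    ent (erasureJoint pX δ) - ent (margA (erasureJoint pX δ))
      = -(δ * Real.logb 2 δ) - (1 - δ) * Real.logb 2 (1 - δ) := by
  obtain ⟨hpos, hsum⟩ := hpX
  have hH : 0 ≤ ent pX := Finset.sum_nonneg fun x _ => phi_nonneg (hpos x).le
    (hsum ▸ Finset.single_le_sum (fun i _ => (hpos i).le) (Finset.mem_univ x))
  have hI : 0 ≤ mi (erasureJoint pX δ) := by
    rw [mi_erasureJoint hsum]
    exact mul_nonneg (by linarith) hH
  have hp (x : 𝓧 × (𝓧 ⊕ Unit)) : 0 ≤ erasureJoint pX δ x := by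
    rcases x with ⟨x, x' | u⟩
    · simp only [erasureJoint, Sum.elim_inl]
      split_ifs
      exacts [mul_nonneg (by linarith) (hpos x).le, le_rfl]
    · exact mul_nonneg hδ0.le (hpos x).le
  have hmain (ε : ℝ) (hε : 0 ≤ ε) : g (erasureJoint pX δ) ε =
      (ent (erasureJoint pX δ) - ent (margA (erasureJoint pX δ)))
        + min ε (mi (erasureJoint pX δ)) := by
    refine IsGreatest.csSup_eq ⟨?_, ?_⟩
    · obtain ⟨l, hl0, hl1, hl⟩ : ∃ l : ℝ, 0 ≤ l ∧ l ≤ 1 ∧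
          l * mi (erasureJoint pX δ) = min ε (mi (erasureJoint pX δ)) := by
        rcases hI.eq_or_lt with h | h
        · exact ⟨0, le_rfl, zero_le_one, by simp [← h, hε]⟩
        · exact ⟨min ε (mi (erasureJoint pX δ)) / mi (erasureJoint pX δ),
            div_nonneg (le_min hε hI) hI, div_le_one_of_le₀ (min_le_right _ _) hI,
            div_mul_cancel₀ _ h.ne'⟩
      have hX := mi_jointXZ_erasureFilter (δ := δ) hsum l
      have hY := mi_jointYZ_erasureFilter (δ := δ) hsum hl0 hl1
      rw [← mi_erasureJoint hsum, hl] at hX hY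
      have hmem := mem_gSet (erasureJoint pX δ) (isChannel_erasureFilter hl0 hl1)
        (hX.trans_le (min_le_left _ _))
      rw [hY] at hmem
      rwa [ent_erasureJoint hsum, margA_erasureJoint, add_sub_cancel_right]
    · rintro r ⟨n, q, hq, hqε, rfl⟩
      rw [← min_add_add_left]
      refine le_min ?_ ?_
      · linarith [mi_jointYZ_le (erasureJoint pX δ) hp hq]
      · have := mi_jointYZ_le_ent (erasureJoint pX δ) hp hq
        simp only [mi] at this ⊢
        linarith
  refine ⟨hmain, ?_, ?_⟩
  · rw [hmain 0 le_rfl, min_eq_left hI, add_zero]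
  · rw [ent_erasureJoint hsum, margA_erasureJoint, phi, phi]
    ring

end RatePrivacy
end
end

section
/- Let (X,Y) be jointly Gaussian random variables with positive variances and correlation coefficient ρ with 0 < ρ² < 1. Then for every ε ∈ [0, I(X;Y)), where I(X;Y) = (1/2)·log(1/(1−ρ²)), the Gaussian-filter rate-privacy function satisfies g_ε(X;Y) = (1/2)·log( ρ² / (2^{−2ε} + ρ² − 1) ); the supremum is attained at γ² = ((2^{−2ε}+ρ²−1)/(1−2^{−2ε}))·var(Y). In particular g_0(X;Y) = 0. -/
open MeasureTheory ProbabilityTheory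

noncomputable section

namespace GaussPrivacy

open Classical in
/-- Mutual information (in bits) between real-valued random variables `U` and `V` on
`(Ω, μ)`, defined as the Kullback–Leibler divergence of the joint law from the product of
the marginal laws: it is `∫ log (dP_{UV}/d(P_U ⊗ P_V)) dP_{UV} / log 2` when
`P_{UV} ≪ P_U ⊗ P_V` with integrable log-likelihood ratio, and `⊤` otherwise. -/
def miE {Ω : Type*} [MeasurableSpace Ω] (μ : Measure Ω) (U V : Ω → ℝ) : EReal :=
  if (μ.map fun ω => (U ω, V ω)) ≪ (μ.map U).prod (μ.map V) ∧
      Integrable (llr (μ.map fun ω => (U ω, V ω)) ((μ.map U).prod (μ.map V)))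
        (μ.map fun ω => (U ω, V ω))
  then (((∫ x, llr (μ.map fun ω => (U ω, V ω)) ((μ.map U).prod (μ.map V)) x
      ∂(μ.map fun ω => (U ω, V ω))) / Real.log 2 : ℝ) : EReal)
  else ⊤

/-- Three independent standard Gaussian coordinates: the underlying probability space. -/
def μ3 : Measure (ℝ × ℝ × ℝ) :=
  (gaussianReal 0 1).prod ((gaussianReal 0 1).prod (gaussianReal 0 1))

/-- The private data `X`: a Gaussian with mean `mX` and standard deviation `sX`. -/
def Xg (mX sX : ℝ) : ℝ × ℝ × ℝ → ℝ := fun ω => mX + sX * ω.1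

/-- The observable data `Y`, jointly Gaussian with `X`, with mean `mY`, standard deviation
`sY`, and correlation coefficient `ρ` with `X`. -/
def Yg (mY sY ρ : ℝ) : ℝ × ℝ × ℝ → ℝ :=
  fun ω => mY + sY * (ρ * ω.1 + Real.sqrt (1 - ρ ^ 2) * ω.2.1)

/-- The output `Z_γ = Y + γ N` of the additive Gaussian privacy filter, where `N` is a
standard Gaussian independent of `(X, Y)`. -/
def Zg (mY sY ρ γ : ℝ) : ℝ × ℝ × ℝ → ℝ :=
  fun ω => Yg mY sY ρ ω + γ * ω.2.2

/-- The Gaussian-filter rate-privacy function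
`g_ε(X;Y) = sup { I(Y;Z_γ) : γ ≥ 0, I(X;Z_γ) ≤ ε }` (in bits). -/
def gG (mX mY sX sY ρ : ℝ) (ε : ℝ) : ℝ :=
  sSup { r : ℝ | ∃ γ : ℝ, 0 ≤ γ ∧
    miE μ3 (Xg mX sX) (Zg mY sY ρ γ) ≤ (ε : EReal) ∧
    (r : EReal) = miE μ3 (Yg mY sY ρ) (Zg mY sY ρ γ) }

/-- The optimal noise level: `γ² = ((2^{−2ε}+ρ²−1)/(1−2^{−2ε}))·var(Y)`. -/
def γopt (sY ρ ε : ℝ) : ℝ :=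
  Real.sqrt ((((2 : ℝ) ^ (-(2 * ε)) + ρ ^ 2 - 1) / (1 - (2 : ℝ) ^ (-(2 * ε)))) * sY ^ 2)

open scoped NNReal ENNReal

theorem integral_sq_sub_gaussianReal (m : ℝ) (v : ℝ≥0) :
    ∫ x, (x - m) ^ 2 ∂(gaussianReal m v) = v := by
  have h := variance_fun_id_gaussianReal (μ := m) (v := v)
  rw [variance_eq_integral (by fun_prop)] at h
  simpa using h

theorem integrable_sq_sub_gaussianReal (m : ℝ) (v : ℝ≥0) :
    Integrable (fun x => (x - m) ^ 2) (gaussianReal m v) :=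
  (((memLp_id_gaussianReal (μ := m) (v := v) 2).sub (memLp_const m)).integrable_sq)

theorem log_gaussianPDFReal (m : ℝ) {v : ℝ≥0} (hv : v ≠ 0) (x : ℝ) :
    Real.log (gaussianPDFReal m v x)
      = -(1 / 2 * Real.log (2 * Real.pi * v)) - (x - m) ^ 2 / (2 * v) := by
  have hv' : (0 : ℝ) < v := by positivity
  have hp : (0 : ℝ) < 2 * Real.pi * v := by positivity
  rw [gaussianPDFReal_def, Real.log_mul (by positivity) (by positivity), Real.log_exp,
    Real.log_inv, Real.log_sqrt hp.le]
  ring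

theorem measurable_gaussianPDF_div (c m₂ mV : ℝ) (v₂ vV : ℝ≥0) :
    Measurable fun p : ℝ × ℝ =>
      gaussianPDF (c * p.1 + m₂) v₂ p.2 / gaussianPDF mV vV p.2 := by
  refine Measurable.div ?_ ?_
  · exact measurable_uncurry_gaussianPDF.comp
      (f := fun p : ℝ × ℝ => (c * p.1 + m₂, v₂, p.2)) (by fun_prop)
  · exact (measurable_gaussianPDF _ _).comp measurable_snd

theorem map_prodMk_eq_withDensity {m₁ m₂ mV : ℝ} {v₁ v₂ vV : ℝ≥0} (hv₂ : v₂ ≠ 0) (hvV : vV ≠ 0)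
    (c : ℝ) :
    ((gaussianReal m₁ v₁).prod (gaussianReal m₂ v₂)).map (fun p => (p.1, c * p.1 + p.2))
      = ((gaussianReal m₁ v₁).prod (gaussianReal mV vV)).withDensity
        (fun p => gaussianPDF (c * p.1 + m₂) v₂ p.2 / gaussianPDF mV vV p.2) := by
  have hd := measurable_gaussianPDF_div c m₂ mV v₂ vV
  refine Measure.ext_of_lintegral _ fun f hf => ?_
  rw [lintegral_map hf (by fun_prop), lintegral_prod _ (by fun_prop),
    lintegral_withDensity_eq_lintegral_mul _ hd hf, lintegral_prod _ (by fun_prop)]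
  refine lintegral_congr fun x => ?_
  have h1 : ∫⁻ y, f (x, c * x + y) ∂(gaussianReal m₂ v₂)
      = ∫⁻ y, f (x, y) ∂(gaussianReal (m₂ + c * x) v₂) := by
    rw [← gaussianReal_map_const_add, lintegral_map (by fun_prop) (by fun_prop)]
  rw [h1, gaussianReal_of_var_ne_zero _ hv₂, gaussianReal_of_var_ne_zero _ hvV,
    lintegral_withDensity_eq_lintegral_mul _ (measurable_gaussianPDF _ _) (by fun_prop),
    lintegral_withDensity_eq_lintegral_mul _ (measurable_gaussianPDF _ _) (by fun_prop)]
  refine lintegral_congr fun y => ?_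
  simp only [Pi.mul_apply]
  rw [← mul_assoc, ENNReal.mul_div_cancel (gaussianPDF_pos _ hvV y).ne' gaussianPDF_ne_top,
    add_comm m₂]

theorem hasLaw_gaussianReal_add {Ω : Type*} [MeasurableSpace Ω] {μ : Measure Ω} {U W : Ω → ℝ}
    {m₁ m₂ : ℝ} {v₁ v₂ : ℝ≥0} (hU : HasLaw U (gaussianReal m₁ v₁) μ)
    (hW : HasLaw W (gaussianReal m₂ v₂) μ) (h : IndepFun U W μ) :
    HasLaw (fun ω => U ω + W ω) (gaussianReal (m₁ + m₂) (v₁ + v₂)) μ :=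
  ⟨hU.aemeasurable.add hW.aemeasurable,
    gaussianReal_add_gaussianReal_of_indepFun h hU.map_eq hW.map_eq⟩

/-- Mutual information across an additive Gaussian noise channel with Gaussian input. -/
theorem miE_gaussian_channel {Ω : Type*} [MeasurableSpace Ω] {μ : Measure Ω}
    [IsProbabilityMeasure μ] {U W : Ω → ℝ} {m₁ m₂ : ℝ} {v₁ v₂ : ℝ≥0}
    (hU : HasLaw U (gaussianReal m₁ v₁) μ) (hW : HasLaw W (gaussianReal m₂ v₂) μ)
    (h : IndepFun U W μ) (hv₂ : v₂ ≠ 0) (c : ℝ) :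
    miE μ U (fun ω => c * U ω + W ω)
      = ((1 / 2 * Real.logb 2 (1 + c ^ 2 * v₁ / v₂) : ℝ) : EReal) := by
  have hmU := hU.aemeasurable
  have hmW := hW.aemeasurable
  have hV := hasLaw_gaussianReal_add (gaussianReal_const_mul hU c) hW
    (h.comp (measurable_const_mul c) measurable_id)
  set mV := c * m₁ + m₂
  set vV : ℝ≥0 := .mk (c ^ 2) (sq_nonneg _) * v₁ + v₂ with hvVdef
  have hvV : vV ≠ 0 := by
    rw [hvVdef]; exact fun h0 => hv₂ (add_eq_zero.mp h0).2
  have hvV' : (vV : ℝ) = c ^ 2 * v₁ + v₂ := by simp [hvVdef]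
  have p2 : (0 : ℝ) < v₂ := by positivity
  have pV : (0 : ℝ) < vV := by positivity
  set V : Ω → ℝ := fun ω => c * U ω + W ω with hVdef
  have hmV : AEMeasurable V μ := hV.aemeasurable
  set d : ℝ × ℝ → ℝ≥0∞ :=
    fun p => gaussianPDF (c * p.1 + m₂) v₂ p.2 / gaussianPDF mV vV p.2 with hddef
  have hdm : Measurable d := measurable_gaussianPDF_div c m₂ mV v₂ vV
  have hJ : (μ.map fun ω => (U ω, V ω)) = ((μ.map U).prod (μ.map V)).withDensity d := by
    rw [hU.map_eq, hV.map_eq, hddef, ← map_prodMk_eq_withDensity hv₂ hvV c, ← hU.map_eq,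
      ← hW.map_eq, ← h.map_prod_eq_prod_map_map hmU hmW,
      AEMeasurable.map_map_of_aemeasurable (by fun_prop) (by fun_prop)]
    rfl
  have hac : (μ.map fun ω => (U ω, V ω)) ≪ (μ.map U).prod (μ.map V) :=
    hJ ▸ withDensity_absolutelyContinuous _ _
  have : IsProbabilityMeasure (μ.map U) := Measure.isProbabilityMeasure_map hmU
  have : IsProbabilityMeasure (μ.map V) := Measure.isProbabilityMeasure_map hmV
  let K : ℝ := 1 / 2 * Real.log (vV / v₂)
  let q : ℝ × ℝ → ℝ := fun p =>
    K - (p.2 - c * p.1 - m₂) ^ 2 / (2 * v₂) + (p.2 - mV) ^ 2 / (2 * vV)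
  have hllr : llr (μ.map fun ω => (U ω, V ω)) ((μ.map U).prod (μ.map V))
      =ᵐ[μ.map fun ω => (U ω, V ω)] q := by
    have hrn := Measure.rnDeriv_withDensity ((μ.map U).prod (μ.map V)) hdm
    rw [← hJ] at hrn
    filter_upwards [hac hrn] with p hp
    rw [llr_def]
    simp only [hp, hddef, ENNReal.toReal_div, toReal_gaussianPDF]
    rw [Real.log_div (gaussianPDFReal_pos _ _ _ hv₂).ne' (gaussianPDFReal_pos _ _ _ hvV).ne',
      log_gaussianPDFReal _ hv₂, log_gaussianPDFReal _ hvV,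
      Real.log_mul (by positivity) p2.ne', Real.log_mul (by positivity) pV.ne']
    simp only [q, K]
    rw [Real.log_div pV.ne' p2.ne']
    ring
  have hIW : Integrable (fun ω => (W ω - m₂) ^ 2) μ :=
    (hW.map_eq ▸ integrable_sq_sub_gaussianReal m₂ v₂ :
      Integrable (fun x => (x - m₂) ^ 2) (μ.map W)).comp_aemeasurable hmW
  have hIV : Integrable (fun ω => (V ω - mV) ^ 2) μ :=
    (hV.map_eq ▸ integrable_sq_sub_gaussianReal mV vV :
      Integrable (fun x => (x - mV) ^ 2) (μ.map V)).comp_aemeasurable hmV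
  have hEW : ∫ ω, (W ω - m₂) ^ 2 ∂μ = v₂ := by
    rw [← integral_sq_sub_gaussianReal m₂ v₂, ← hW.map_eq,
      integral_map hmW (by fun_prop)]
  have hEV : ∫ ω, (V ω - mV) ^ 2 ∂μ = vV := by
    rw [← integral_sq_sub_gaussianReal mV vV, ← hV.map_eq,
      integral_map hmV (by fun_prop)]
  have hqm : Measurable q := by fun_prop
  have hqc : (fun ω => q (U ω, V ω))
      = fun ω => K - (W ω - m₂) ^ 2 / (2 * v₂) + (V ω - mV) ^ 2 / (2 * vV) := by
    funext ω
    simp only [q, hVdef]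
    ring
  have hIKW : Integrable (fun ω => K - (W ω - m₂) ^ 2 / (2 * v₂)) μ :=
    (integrable_const K).sub (hIW.div_const _)
  have hIq : Integrable q (μ.map fun ω => (U ω, V ω)) := by
    rw [integrable_map_measure hqm.aestronglyMeasurable (by fun_prop)]
    change Integrable (fun ω => q (U ω, V ω)) μ
    rw [hqc]
    exact hIKW.add (hIV.div_const _)
  have hint : ∫ p, q p ∂(μ.map fun ω => (U ω, V ω)) = K := by
    rw [integral_map (by fun_prop) hqm.aestronglyMeasurable, hqc,
      integral_add hIKW (hIV.div_const _),
      integral_sub (integrable_const K) (hIW.div_const _), integral_div, integral_div, hEW, hEV]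
    simp
    field_simp
    ring
  rw [miE, if_pos ⟨hac, hIq.congr hllr.symm⟩, integral_congr_ae hllr, hint]
  have hr : (vV : ℝ) / v₂ = 1 + c ^ 2 * v₁ / v₂ := by
    rw [hvV']; field_simp; ring
  simp only [K, hr, Real.logb]
  congr 1
  ring

instance : IsProbabilityMeasure μ3 := by unfold μ3; infer_instance

theorem hasLaw_fst_μ3 : HasLaw (fun ω : ℝ × ℝ × ℝ => ω.1) (gaussianReal 0 1) μ3 :=
  ⟨by fun_prop, measurePreserving_fst.map_eq⟩

theorem hasLaw_snd_fst_μ3 : HasLaw (fun ω : ℝ × ℝ × ℝ => ω.2.1) (gaussianReal 0 1) μ3 :=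
  ⟨by fun_prop, (measurePreserving_fst.comp measurePreserving_snd).map_eq⟩

theorem hasLaw_snd_snd_μ3 : HasLaw (fun ω : ℝ × ℝ × ℝ => ω.2.2) (gaussianReal 0 1) μ3 :=
  ⟨by fun_prop, (measurePreserving_snd.comp measurePreserving_snd).map_eq⟩

theorem indepFun_fst_μ3 {f : ℝ → ℝ} {g : ℝ × ℝ → ℝ} (hf : Measurable f) (hg : Measurable g) :
    IndepFun (fun ω : ℝ × ℝ × ℝ => f ω.1) (fun ω => g ω.2) μ3 :=
  indepFun_prod hf hg

theorem indepFun_snd_snd_μ3 {f : ℝ × ℝ → ℝ} {g : ℝ → ℝ} (hf : Measurable f) (hg : Measurable g) :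
    IndepFun (fun ω : ℝ × ℝ × ℝ => f (ω.1, ω.2.1)) (fun ω => g ω.2.2) μ3 := by
  have hpres := measurePreserving_prodAssoc (gaussianReal 0 1) (gaussianReal 0 1)
    (gaussianReal 0 1)
  have hi : IndepFun (fun ω : (ℝ × ℝ) × ℝ => f ω.1) (fun ω => g ω.2)
      (((gaussianReal 0 1).prod (gaussianReal 0 1)).prod (gaussianReal 0 1)) :=
    indepFun_prod hf hg
  rw [indepFun_iff_map_prod_eq_prod_map_map (by fun_prop) (by fun_prop)] at hi ⊢
  unfold μ3
  rw [← hpres.map_eq, Measure.map_map (by fun_prop) hpres.measurable,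
    Measure.map_map (by fun_prop) hpres.measurable, Measure.map_map (by fun_prop) hpres.measurable]
  exact hi

theorem indepFun_snd_fst_μ3 {f g : ℝ → ℝ} (hf : Measurable f) (hg : Measurable g) :
    IndepFun (fun ω : ℝ × ℝ × ℝ => f ω.2.1) (fun ω => g ω.2.2) μ3 :=
  indepFun_snd_snd_μ3 (f := fun p => f p.2) (by fun_prop) hg

theorem miE_Xg_Zg (mX mY : ℝ) {sX sY ρ : ℝ} (hsX : 0 < sX) (hsY : 0 < sY) (hρ1 : ρ ^ 2 < 1)
    (γ : ℝ) :
    miE μ3 (Xg mX sX) (Zg mY sY ρ γ)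
      = ((1 / 2 * Real.logb 2
          (1 + sY ^ 2 * ρ ^ 2 / (sY ^ 2 * (1 - ρ ^ 2) + γ ^ 2)) : ℝ) : EReal) := by
  have hX := gaussianReal_const_add (gaussianReal_const_mul hasLaw_fst_μ3 sX) mX
  have hW := gaussianReal_const_add (hasLaw_gaussianReal_add
    (gaussianReal_const_mul hasLaw_snd_fst_μ3 (sY * √(1 - ρ ^ 2)))
    (gaussianReal_const_mul hasLaw_snd_snd_μ3 γ)
    (indepFun_snd_fst_μ3 (measurable_const_mul _) (measurable_const_mul _)))
    (mY - sY * ρ / sX * mX)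
  have hind : IndepFun (Xg mX sX) (fun ω : ℝ × ℝ × ℝ =>
      mY - sY * ρ / sX * mX + (sY * √(1 - ρ ^ 2) * ω.2.1 + γ * ω.2.2)) μ3 :=
    indepFun_fst_μ3 (f := fun x => mX + sX * x)
      (g := fun p => mY - sY * ρ / sX * mX + (sY * √(1 - ρ ^ 2) * p.1 + γ * p.2))
      (by fun_prop) (by fun_prop)
  have hρ : 0 < 1 - ρ ^ 2 := by linarith
  have hv := miE_gaussian_channel hX hW hind (by
    rw [← NNReal.coe_ne_zero]
    simp only [NNReal.coe_add, NNReal.coe_mul, NNReal.coe_mk, NNReal.coe_one]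
    positivity) (sY * ρ / sX)
  have hZ : Zg mY sY ρ γ = fun ω => sY * ρ / sX * (Xg mX sX ω) +
      (mY - sY * ρ / sX * mX + (sY * √(1 - ρ ^ 2) * ω.2.1 + γ * ω.2.2)) := by
    funext ω
    simp only [Zg, Yg, Xg]
    field_simp
    ring
  rw [hZ]
  refine hv.trans ?_
  simp only [NNReal.coe_add, NNReal.coe_mk, mul_one, mul_pow,
    Real.sq_sqrt hρ.le]
  congr 5
  field_simp

theorem miE_Yg_Zg (mY : ℝ) {sY ρ γ : ℝ} (hρ1 : ρ ^ 2 < 1) (hγ : γ ≠ 0) :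
    miE μ3 (Yg mY sY ρ) (Zg mY sY ρ γ)
      = ((1 / 2 * Real.logb 2 (1 + sY ^ 2 / γ ^ 2) : ℝ) : EReal) := by
  have hY := gaussianReal_const_add (gaussianReal_const_mul (hasLaw_gaussianReal_add
    (gaussianReal_const_mul hasLaw_fst_μ3 ρ)
    (gaussianReal_const_mul hasLaw_snd_fst_μ3 √(1 - ρ ^ 2))
    (indepFun_fst_μ3 (g := fun p => √(1 - ρ ^ 2) * p.1)
      (measurable_const_mul _) (by fun_prop))) sY) mY
  have hρ : 0 < 1 - ρ ^ 2 := by linarith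
  have hind : IndepFun (Yg mY sY ρ) (fun ω : ℝ × ℝ × ℝ => γ * ω.2.2) μ3 :=
    indepFun_snd_snd_μ3 (f := fun p => mY + sY * (ρ * p.1 + √(1 - ρ ^ 2) * p.2))
      (by fun_prop) (measurable_const_mul γ)
  have hv := miE_gaussian_channel hY (gaussianReal_const_mul hasLaw_snd_snd_μ3 γ) hind (by
    rw [← NNReal.coe_ne_zero]
    simp only [NNReal.coe_mul, NNReal.coe_mk, NNReal.coe_one]
    positivity) 1
  have hZ : Zg mY sY ρ γ = fun ω => 1 * Yg mY sY ρ ω + γ * ω.2.2 := by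
    funext ω
    simp [Zg]
  rw [hZ]
  refine hv.trans ?_
  simp only [NNReal.coe_add, NNReal.coe_mul, NNReal.coe_mk, mul_one, one_pow,
    one_mul, Real.sq_sqrt hρ.le, add_sub_cancel]

theorem half_logb_le_iff {x : ℝ} (hx : 0 < x) (ε : ℝ) :
    1 / 2 * Real.logb 2 x ≤ ε ↔ x ≤ ((2 : ℝ) ^ (-(2 * ε)))⁻¹ := by
  rw [← Real.rpow_neg zero_le_two, neg_neg, ← Real.logb_le_iff_le_rpow one_lt_two hx]
  constructor <;> intro h <;> linarith

theorem miE_Xg_Zg_le_iff (mX mY : ℝ) {sX sY ρ ε : ℝ} (hsX : 0 < sX) (hsY : 0 < sY)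
    (hρ1 : ρ ^ 2 < 1) (γ : ℝ) :
    miE μ3 (Xg mX sX) (Zg mY sY ρ γ) ≤ (ε : EReal) ↔
      ((2 : ℝ) ^ (-(2 * ε)) + ρ ^ 2 - 1) * sY ^ 2 ≤ (1 - (2 : ℝ) ^ (-(2 * ε))) * γ ^ 2 := by
  have hρ : 0 < 1 - ρ ^ 2 := by linarith
  have ht : 0 < (2 : ℝ) ^ (-(2 * ε)) := by positivity
  have hs : 0 < sY ^ 2 * (1 - ρ ^ 2) + γ ^ 2 := by positivity
  rw [miE_Xg_Zg mX mY hsX hsY hρ1, EReal.coe_le_coe_iff, half_logb_le_iff (by positivity),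
    one_add_div hs.ne', div_le_iff₀ hs, ← div_eq_inv_mul, le_div_iff₀ ht]
  constructor <;> intro h <;> linarith

theorem lt_half_logb_iff {ρ : ℝ} (hρ1 : ρ ^ 2 < 1) (ε : ℝ) :
    ε < 1 / 2 * Real.logb 2 (1 / (1 - ρ ^ 2)) ↔ 0 < (2 : ℝ) ^ (-(2 * ε)) + ρ ^ 2 - 1 := by
  have hρ : 0 < 1 - ρ ^ 2 := by linarith
  have ht : 0 < (2 : ℝ) ^ (-(2 * ε)) := by positivity
  rw [← not_le, half_logb_le_iff (by positivity), one_div, inv_le_inv₀ hρ ht, not_le]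
  constructor <;> intro h <;> linarith

theorem gG_zero (mX mY : ℝ) {sX sY ρ : ℝ} (hsX : 0 < sX) (hsY : 0 < sY)
    (hρ0 : 0 < ρ ^ 2) (hρ1 : ρ ^ 2 < 1) : gG mX mY sX sY ρ 0 = 0 := by
  rw [gG, ← Real.sSup_empty]
  congr 1
  refine Set.eq_empty_of_forall_notMem ?_
  rintro r ⟨γ, -, hle, -⟩
  rw [miE_Xg_Zg_le_iff mX mY hsX hsY hρ1] at hle
  have : 0 < ρ ^ 2 * sY ^ 2 := by positivity
  norm_num at hle
  linarith

/-- For positive `ε`, the filter with noise level `γopt` is feasible and realizes the largest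
utility. -/
theorem isGreatest_gG (mX mY : ℝ) {sX sY ρ ε : ℝ} (hsX : 0 < sX) (hsY : 0 < sY)
    (hρ1 : ρ ^ 2 < 1) (hε : 0 < ε) (hεI : ε < 1 / 2 * Real.logb 2 (1 / (1 - ρ ^ 2))) :
    miE μ3 (Xg mX sX) (Zg mY sY ρ (γopt sY ρ ε)) ≤ (ε : EReal) ∧
    miE μ3 (Yg mY sY ρ) (Zg mY sY ρ (γopt sY ρ ε)) =
      ((1 / 2 * Real.logb 2 (ρ ^ 2 / ((2 : ℝ) ^ (-(2 * ε)) + ρ ^ 2 - 1)) : ℝ) : EReal) ∧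
    gG mX mY sX sY ρ ε
      = 1 / 2 * Real.logb 2 (ρ ^ 2 / ((2 : ℝ) ^ (-(2 * ε)) + ρ ^ 2 - 1)) := by
  have hA := (lt_half_logb_iff hρ1 ε).mp hεI
  have hB : 0 < 1 - (2 : ℝ) ^ (-(2 * ε)) :=
    sub_pos.mpr (Real.rpow_lt_one_of_one_lt_of_neg one_lt_two (by linarith))
  have hopt : γopt sY ρ ε ^ 2 =
      ((2 : ℝ) ^ (-(2 * ε)) + ρ ^ 2 - 1) / (1 - (2 : ℝ) ^ (-(2 * ε))) * sY ^ 2 := by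
    rw [γopt, Real.sq_sqrt (by positivity)]
  have hopt0 : 0 < γopt sY ρ ε := Real.sqrt_pos.mpr (by positivity)
  have hle : miE μ3 (Xg mX sX) (Zg mY sY ρ (γopt sY ρ ε)) ≤ (ε : EReal) := by
    rw [miE_Xg_Zg_le_iff mX mY hsX hsY hρ1, hopt]
    field_simp
    exact le_rfl
  have hval : 1 + sY ^ 2 / γopt sY ρ ε ^ 2 = ρ ^ 2 / ((2 : ℝ) ^ (-(2 * ε)) + ρ ^ 2 - 1) := by
    rw [hopt]
    field_simp
    ring
  have heq := miE_Yg_Zg mY (sY := sY) hρ1 hopt0.ne'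
  rw [hval] at heq
  refine ⟨hle, heq, IsGreatest.csSup_eq ⟨⟨_, hopt0.le, hle, heq.symm⟩, ?_⟩⟩
  rintro r ⟨γ, hγ, hγle, hr⟩
  rw [miE_Xg_Zg_le_iff mX mY hsX hsY hρ1] at hγle
  have hlow : γopt sY ρ ε ^ 2 ≤ γ ^ 2 := by
    rw [hopt, div_mul_eq_mul_div, div_le_iff₀ hB]
    linarith
  have hγ2 : 0 < γ ^ 2 := (pow_pos hopt0 2).trans_le hlow
  rw [miE_Yg_Zg mY hρ1 (pow_ne_zero_iff two_ne_zero |>.mp hγ2.ne'), EReal.coe_eq_coe_iff] at hr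
  rw [hr, ← hval]
  refine mul_le_mul_of_nonneg_left (Real.logb_le_logb_of_le one_lt_two (by positivity) ?_)
    (by norm_num)
  gcongr

/-- Let `(X,Y)` be jointly Gaussian with positive variances and
correlation coefficient `ρ`, `0 < ρ² < 1`.  Then `I(X;Y) = (1/2)·log(1/(1−ρ²))`, and for
every `ε ∈ [0, I(X;Y))`, `g_ε(X;Y) = (1/2)·log(ρ²/(2^{−2ε}+ρ²−1))`; for `ε ∈ (0, I(X;Y))`
the supremum is attained at `γ² = ((2^{−2ε}+ρ²−1)/(1−2^{−2ε}))·var(Y)`.  In particular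
`g_0(X;Y) = 0`.  (Logarithms are base 2.) -/
theorem stmt18 (mX mY sX sY ρ : ℝ) (hsX : 0 < sX) (hsY : 0 < sY)
    (hρ0 : 0 < ρ ^ 2) (hρ1 : ρ ^ 2 < 1) :
    miE μ3 (Xg mX sX) (Yg mY sY ρ)
      = (((1 : ℝ) / 2 * Real.logb 2 (1 / (1 - ρ ^ 2)) : ℝ) : EReal) ∧
    (∀ ε : ℝ, 0 ≤ ε → ε < 1 / 2 * Real.logb 2 (1 / (1 - ρ ^ 2)) →
      gG mX mY sX sY ρ ε
        = 1 / 2 * Real.logb 2 (ρ ^ 2 / ((2 : ℝ) ^ (-(2 * ε)) + ρ ^ 2 - 1))) ∧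
    (∀ ε : ℝ, 0 < ε → ε < 1 / 2 * Real.logb 2 (1 / (1 - ρ ^ 2)) →
      miE μ3 (Xg mX sX) (Zg mY sY ρ (γopt sY ρ ε)) ≤ (ε : EReal) ∧
      ((gG mX mY sX sY ρ ε : ℝ) : EReal)
        = miE μ3 (Yg mY sY ρ) (Zg mY sY ρ (γopt sY ρ ε))) ∧
    gG mX mY sX sY ρ 0 = 0 := by
  have hXY := miE_Xg_Zg mX mY hsX hsY hρ1 0
  have hZ0 : Zg mY sY ρ 0 = Yg mY sY ρ := by
    funext ω
    simp [Zg]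
  have hρ : 1 - ρ ^ 2 ≠ 0 := by linarith
  have hI : 1 + sY ^ 2 * ρ ^ 2 / (sY ^ 2 * (1 - ρ ^ 2) + 0 ^ 2) = 1 / (1 - ρ ^ 2) := by
    field_simp
    ring
  rw [hZ0, hI] at hXY
  refine ⟨hXY, fun ε hε hεI => ?_, fun ε hε hεI => ?_, gG_zero mX mY hsX hsY hρ0 hρ1⟩
  · rcases hε.eq_or_lt with rfl | hε
    · rw [gG_zero mX mY hsX hsY hρ0 hρ1]
      simp [hρ0.ne']
    · exact (isGreatest_gG mX mY hsX hsY hρ1 hε hεI).2.2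
  · obtain ⟨hle, heq, hg⟩ := isGreatest_gG mX mY hsX hsY hρ1 hε hεI
    exact ⟨hle, by rw [hg, heq]⟩

end GaussPrivacy
end
end
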